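/- arXiv:math/9812123 — 2 statements merged into one kernel-verified Lean document; each statement's English description precedes it below -/
import Mathlib

section
/- Let 1 ≤ k < n be integers. Then f(0,k,n) = 2^k · binom(n,k) · √(2k/π) · ∫_0^∞ e^{-k t²/2} · (√(2/π) ∫_0^t e^{-x²/2} dx)^{n-k} dt. (Equivalently, H({g ∈ O(n) : g E_k ∩ F_{n-k} ≠ ∅}) = √(2k/π) ∫_0^∞ e^{-k t²/2} (√(2/π) ∫_0^t e^{-x²/2} dx)^{n-k} dt.) -/
open MeasureTheory Filter Real

noncomputable section

/-- The orthogonal group O(n) of ℝⁿ. -/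
abbrev OG (n : ℕ) : Type := Matrix.orthogonalGroup (Fin n) ℝ

instance (n : ℕ) : MeasurableSpace (OG n) := borel _
instance (n : ℕ) : BorelSpace (OG n) := ⟨rfl⟩

/-- The natural action of `g ∈ O(n)` on `ℝⁿ`. -/
def act {n : ℕ} (g : OG n) (x : EuclideanSpace ℝ (Fin n)) : EuclideanSpace ℝ (Fin n) :=
  Matrix.toEuclideanLin (g : Matrix (Fin n) (Fin n) ℝ) x

/-- `E_k`: the span of the first `k` standard basis vectors of `ℝⁿ`, as a set. -/
def Ek (n k : ℕ) : Set (EuclideanSpace ℝ (Fin n)) :=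
  {x | ∀ i : Fin n, k ≤ (i : ℕ) → x i = 0}

/-- The `m`-dimensional face `{x : |xᵢ| ≤ 1 for i < m, xᵢ = 1 for i ≥ m}` of the cube `[-1,1]ⁿ`. -/
def cubeFace (n m : ℕ) : Set (EuclideanSpace ℝ (Fin n)) :=
  {x | (∀ i : Fin n, (i : ℕ) < m → |x i| ≤ 1) ∧ ∀ i : Fin n, m ≤ (i : ℕ) → x i = 1}

/-- `f(j,k,n)`, the expected number of `j`-faces of a random `k`-section of the `n`-cube,
computed with respect to the probability measure `H` on `O(n)`. -/
def expFaces (n : ℕ) (H : Measure (OG n)) (j k : ℕ) : ℝ :=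
  2 ^ (k - j) * (n.choose (k - j)) *
    (H {g | (act g '' Ek n k ∩ cubeFace n (n - k + j)).Nonempty}).toReal

open ProbabilityTheory
instance OG_cm (n : ℕ) : ContinuousMul (OG n) := inferInstance

theorem OG_inv_coe {n : ℕ} (g : OG n) : ((g⁻¹ : OG n) : Matrix (Fin n) (Fin n) ℝ) = (g : Matrix (Fin n) (Fin n) ℝ).transpose := by
  rfl

theorem OG_mul_tr {n : ℕ} (g : OG n) : (g : Matrix (Fin n) (Fin n) ℝ) * (g : Matrix (Fin n) (Fin n) ℝ).transpose = 1 :=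
  (Matrix.mem_orthogonalGroup_iff (Fin n) ℝ).1 g.2

theorem OG_tr_mul {n : ℕ} (g : OG n) : (g : Matrix (Fin n) (Fin n) ℝ).transpose * (g : Matrix (Fin n) (Fin n) ℝ) = 1 :=
  (Matrix.mem_orthogonalGroup_iff' (Fin n) ℝ).1 g.2

instance OG_tg (n : ℕ) : IsTopologicalGroup (OG n) where
  continuous_inv := by
    refine continuous_induced_rng.2 ?_
    exact continuous_subtype_val.matrix_transpose

instance OG_sc (n : ℕ) : SecondCountableTopology (OG n) := by
  haveI : SecondCountableTopology (Matrix (Fin n) (Fin n) ℝ) :=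
    inferInstanceAs (SecondCountableTopology (Fin n → Fin n → ℝ))
  exact TopologicalSpace.Subtype.secondCountableTopology _
instance OG_t2 (n : ℕ) : T2Space (OG n) := inferInstance

theorem OG_entry {n : ℕ} (g : OG n) (i j : Fin n) : |(g : Matrix (Fin n) (Fin n) ℝ) i j| ≤ 1 := by
  have h := congrFun (congrFun (OG_mul_tr g) i) i
  simp only [Matrix.mul_apply, Matrix.transpose_apply, Matrix.one_apply_eq] at h
  have := Finset.single_le_sum (f := fun j => (g : Matrix (Fin n) (Fin n) ℝ) i j * (g : Matrix (Fin n) (Fin n) ℝ) i j) (fun j _ => mul_self_nonneg _) (Finset.mem_univ j)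
  rw [h] at this
  rw [abs_le_one_iff_mul_self_le_one]
  exact this

instance OG_cpt (n : ℕ) : CompactSpace (OG n) := by
  apply isCompact_iff_compactSpace.1
  have hc : IsCompact (Set.pi Set.univ fun _ : Fin n => Set.pi Set.univ fun _ : Fin n => Set.Icc (-1 : ℝ) 1) :=
    isCompact_univ_pi fun _ => isCompact_univ_pi fun _ => isCompact_Icc
  refine IsCompact.of_isClosed_subset (X := Matrix (Fin n) (Fin n) ℝ) hc ?_ ?_
  · have : ((Matrix.orthogonalGroup (Fin n) ℝ : Submonoid (Matrix (Fin n) (Fin n) ℝ)) : Set (Matrix (Fin n) (Fin n) ℝ)) = {A | A * A.transpose = 1} := by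
      ext A; exact Matrix.mem_orthogonalGroup_iff (Fin n) ℝ
    rw [this]
    exact isClosed_eq (by fun_prop) continuous_const
  · intro A hA i _ j _
    exact abs_le.1 (OG_entry ⟨A, hA⟩ i j)

theorem exists_haar (d : ℕ) : ∃ ν : Measure (OG d), ν.IsMulLeftInvariant ∧ IsProbabilityMeasure ν := by
  refine ⟨Measure.haarMeasure ⊤, inferInstance, ⟨?_⟩⟩
  exact Measure.haarMeasure_self (K₀ := (⊤ : TopologicalSpace.PositiveCompacts (OG d)))

theorem act_mul {n : ℕ} (g h : OG n) (x : EuclideanSpace ℝ (Fin n)) : act (g * h) x = act g (act h x) := by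
  simp [act]

theorem act_one {n : ℕ} (x : EuclideanSpace ℝ (Fin n)) : act (1 : OG n) x = x := by
  simp [act, Matrix.toLpLin_apply]

theorem act_inv_act {n : ℕ} (g : OG n) (x : EuclideanSpace ℝ (Fin n)) : act g⁻¹ (act g x) = x := by
  rw [← act_mul, inv_mul_cancel, act_one]
theorem act_act_inv {n : ℕ} (g : OG n) (x : EuclideanSpace ℝ (Fin n)) : act g (act g⁻¹ x) = x := by
  rw [← act_mul, mul_inv_cancel, act_one]

theorem act_cont {n : ℕ} : Continuous (fun p : OG n × EuclideanSpace ℝ (Fin n) => act p.1 p.2) := by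
  simp only [act, Matrix.toLpLin_apply]
  refine (PiLp.continuous_toLp 2 _).comp ?_
  exact (continuous_subtype_val.comp continuous_fst).matrix_mulVec ((PiLp.continuous_ofLp 2 _).comp continuous_snd)

theorem act_inner {n : ℕ} (g : OG n) (x y : EuclideanSpace ℝ (Fin n)) : inner ℝ (act g x) (act g y) = inner ℝ x y := by
  simp only [act, Matrix.toLpLin_apply, EuclideanSpace.inner_eq_star_dotProduct, star_trivial]
  rw [Matrix.dotProduct_mulVec, ← Matrix.mulVec_transpose, Matrix.mulVec_mulVec, OG_tr_mul, Matrix.one_mulVec]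

def actLI {n : ℕ} (g : OG n) : EuclideanSpace ℝ (Fin n) ≃ₗᵢ[ℝ] EuclideanSpace ℝ (Fin n) where
  toLinearEquiv := LinearEquiv.ofLinearMap (Matrix.toEuclideanLin (g : Matrix (Fin n) (Fin n) ℝ)) (Matrix.toEuclideanLin ((g⁻¹ : OG n) : Matrix (Fin n) (Fin n) ℝ))
    (LinearMap.ext fun x => act_act_inv g x) (LinearMap.ext fun x => act_inv_act g x)
  norm_map' x := by
    have := act_inner g x x
    rw [real_inner_self_eq_norm_sq, real_inner_self_eq_norm_sq] at this
    exact (sq_eq_sq₀ (norm_nonneg _) (norm_nonneg _)).1 this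

theorem actLI_apply {n : ℕ} (g : OG n) (x) : actLI g x = act g x := rfl

theorem exists_act_eq {n : ℕ} (f : EuclideanSpace ℝ (Fin n) ≃ₗᵢ[ℝ] EuclideanSpace ℝ (Fin n)) : ∃ g : OG n, ∀ x, act g x = f x := by
  let M := Matrix.toEuclideanLin.symm f.toLinearEquiv.toLinearMap
  have hM : Matrix.toEuclideanLin M = f.toLinearEquiv.toLinearMap := by simp [M]
  refine ⟨⟨M, (Matrix.mem_orthogonalGroup_iff' (Fin n) ℝ).2 ?_⟩, fun x => by simp [act, hM]⟩
  ext i j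
  have h := f.inner_map_map (EuclideanSpace.single i 1) (EuclideanSpace.single j 1)
  have h2 : ∀ i, f (EuclideanSpace.single i 1) = Matrix.toEuclideanLin M (EuclideanSpace.single i 1) := fun i => by rw [hM]; rfl
  rw [h2, h2] at h
  simp [Matrix.toLpLin_apply, EuclideanSpace.inner_eq_star_dotProduct] at h
  rw [Matrix.mul_apply]
  simp [dotProduct] at h
  simp only [Matrix.transpose_apply]
  rw [Finset.sum_congr rfl fun x _ => mul_comm (M x i) (M x j), h]
  simp [Matrix.one_apply, Pi.single_apply]

theorem act_transitive {n : ℕ} (x y : EuclideanSpace ℝ (Fin n)) (h : ‖x‖ = ‖y‖) : ∃ g : OG n, act g x = y := by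
  obtain ⟨g, hg⟩ := exists_act_eq ((ℝ ∙ (x - y))ᗮ.reflection)
  exact ⟨g, by rw [hg]; exact Submodule.reflection_sub h⟩

/-- The standard Gaussian measure gives mass zero to proper subspaces. -/
theorem gauss_submodule {d : ℕ} (N : Submodule ℝ (EuclideanSpace ℝ (Fin d))) (hN : N ≠ ⊤) :
    stdGaussian (EuclideanSpace ℝ (Fin d)) (N : Set (EuclideanSpace ℝ (Fin d))) = 0 := by
  have hO : Nᗮ ≠ ⊥ := fun h => hN (Submodule.orthogonal_eq_bot_iff.1 h)
  obtain ⟨a, ha, ha0⟩ := Submodule.exists_mem_ne_zero_of_ne_bot hO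
  let L : StrongDual ℝ (EuclideanSpace ℝ (Fin d)) := innerSL ℝ a
  have hsub : (N : Set (EuclideanSpace ℝ (Fin d))) ⊆ L ⁻¹' {0} := by
    intro x hx
    simp only [L, Set.mem_preimage, Set.mem_singleton_iff, innerSL_apply_apply]
    exact (Submodule.mem_orthogonal' N a).1 ha x hx
  refine measure_mono_null hsub ?_
  rw [← Measure.map_apply L.continuous.measurable (measurableSet_singleton 0),
    IsGaussian.map_eq_gaussianReal]
  have hv : Var[L; stdGaussian (EuclideanSpace ℝ (Fin d))] ≠ 0 := by
    rw [variance_dual_stdGaussian]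
    simp [L, innerSL_apply_norm, ha0]
  have : (Var[L; stdGaussian (EuclideanSpace ℝ (Fin d))]).toNNReal ≠ 0 := by
    rw [Ne, Real.toNNReal_eq_zero, not_le]
    exact lt_of_le_of_ne (variance_nonneg _ _) hv.symm
  have := nullSingletonClass_gaussianReal (μ := (stdGaussian (EuclideanSpace ℝ (Fin d)))[L]) this
  exact measure_singleton 0

theorem act_smul {n : ℕ} (g : OG n) (c : ℝ) (x : EuclideanSpace ℝ (Fin n)) : act g (c • x) = c • act g x := by
  simp [act]
theorem act_add {n : ℕ} (g : OG n) (x y : EuclideanSpace ℝ (Fin n)) : act g (x + y) = act g x + act g y := by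
  simp [act]

theorem act_inv_cont {n : ℕ} : Continuous (fun p : OG n × EuclideanSpace ℝ (Fin n) => act p.1⁻¹ p.2) := by
  simp only [act, Matrix.toLpLin_apply, OG_inv_coe]
  refine (PiLp.continuous_toLp 2 _).comp ?_
  exact (continuous_subtype_val.comp continuous_fst).matrix_transpose.matrix_mulVec
    ((PiLp.continuous_ofLp 2 _).comp continuous_snd)

/-- A random rotation of a fixed nonzero vector has the same direction law as a Gaussian vector. -/
theorem haar_direction {d : ℕ} (ν : Measure (OG d)) [ν.IsMulLeftInvariant] [IsProbabilityMeasure ν]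
    (S : Set (EuclideanSpace ℝ (Fin d))) (hS : MeasurableSet S)
    (hsc : ∀ (c : ℝ) (x : EuclideanSpace ℝ (Fin d)), c ≠ 0 → x ∈ S → c • x ∈ S)
    (v : EuclideanSpace ℝ (Fin d)) (hv : v ≠ 0) :
    ν {h | act h⁻¹ v ∈ S} = stdGaussian (EuclideanSpace ℝ (Fin d)) S := by
  set γ := stdGaussian (EuclideanSpace ℝ (Fin d)) with hγ
  have hconst : ∀ w : EuclideanSpace ℝ (Fin d), w ≠ 0 → ν {h | act h⁻¹ w ∈ S} = ν {h | act h⁻¹ v ∈ S} := by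
    intro w hw
    have hnv : ‖v‖ ≠ 0 := norm_ne_zero_iff.2 hv
    have hnw : ‖w‖ ≠ 0 := norm_ne_zero_iff.2 hw
    have hc : ‖w‖ / ‖v‖ ≠ 0 := div_ne_zero hnw hnv
    obtain ⟨g, hg⟩ := act_transitive ((‖w‖ / ‖v‖) • v) w (by
      rw [norm_smul, norm_div, norm_norm, norm_norm, div_mul_cancel₀ _ hnv])
    have h1 := measure_preimage_mul ν g {h | act h⁻¹ w ∈ S}
    rw [← h1]
    congr 1
    ext h
    simp only [Set.mem_preimage, Set.mem_ofPred_eq, mul_inv_rev, act_mul]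
    rw [← hg, act_inv_act, act_smul]
    constructor
    · intro hh
      have := hsc _ _ (inv_ne_zero hc) hh
      rwa [smul_smul, inv_mul_cancel₀ hc, one_smul] at this
    · exact hsc _ _ hc
  have hcont : Continuous (fun p : OG d × EuclideanSpace ℝ (Fin d) => act p.1⁻¹ p.2) :=
    act_inv_cont
  have hT : MeasurableSet {p : OG d × EuclideanSpace ℝ (Fin d) | act p.1⁻¹ p.2 ∈ S} :=
    hcont.measurable hS
  have e1 : (ν.prod γ) {p : OG d × EuclideanSpace ℝ (Fin d) | act p.1⁻¹ p.2 ∈ S} = γ S := by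
    rw [Measure.prod_apply hT]
    have : ∀ h : OG d, γ (Prod.mk h ⁻¹' {p : OG d × EuclideanSpace ℝ (Fin d) | act p.1⁻¹ p.2 ∈ S}) = γ S := by
      intro h
      conv_rhs => rw [hγ, ← stdGaussian_map (actLI h⁻¹)]
      rw [Measure.map_apply (actLI h⁻¹).continuous.measurable hS]
      rfl
    rw [lintegral_congr this, lintegral_const, measure_univ, mul_one]
  have e2 : (ν.prod γ) {p : OG d × EuclideanSpace ℝ (Fin d) | act p.1⁻¹ p.2 ∈ S} = ν {h | act h⁻¹ v ∈ S} := by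
    rw [Measure.prod_apply_symm hT]
    have hne : ∀ᵐ w ∂γ, w ≠ 0 := by
      rw [ae_iff]
      have := gauss_submodule (d := d) ⊥ (by
        intro h
        have : v ∈ (⊥ : Submodule ℝ (EuclideanSpace ℝ (Fin d))) := by rw [h]; trivial
        exact hv (by simpa using this))
      simpa using this
    rw [lintegral_congr_ae (g := fun _ => ν {h | act h⁻¹ v ∈ S})]
    · simp
    · filter_upwards [hne] with w hw
      exact hconst w hw
  rw [← e2, e1]

/-- Averaging a Haar measure over a continuous family of left translations. -/
theorem haar_avg {n d : ℕ} (H : Measure (OG n)) [H.IsMulLeftInvariant] [IsProbabilityMeasure H]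
    (ν : Measure (OG d)) [IsProbabilityMeasure ν] (σ : OG d → OG n) (hσ : Continuous σ)
    (A : Set (OG n)) (hA : MeasurableSet A) :
    H A = ∫⁻ g, ν {h | σ h * g ∈ A} ∂H := by
  have hc : Continuous (fun p : OG d × OG n => σ p.1 * p.2) :=
    (hσ.comp continuous_fst).mul continuous_snd
  have hT : MeasurableSet {p : OG d × OG n | σ p.1 * p.2 ∈ A} := hc.measurable hA
  have e1 : (ν.prod H) {p : OG d × OG n | σ p.1 * p.2 ∈ A} = H A := by
    rw [Measure.prod_apply hT]
    have : ∀ h, H (Prod.mk h ⁻¹' {p : OG d × OG n | σ p.1 * p.2 ∈ A}) = H A := fun h =>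
      measure_preimage_mul H (σ h) A
    rw [lintegral_congr this, lintegral_const, measure_univ, mul_one]
  rw [← e1, Measure.prod_apply_symm hT]
  rfl

/-- Sets of rotations defined by a hitting condition are closed. -/
theorem closed_hit {n : ℕ} (K C : Set (EuclideanSpace ℝ (Fin n))) (hK : IsCompact K) (hC : IsClosed C) :
    MeasurableSet {g : OG n | ∃ x ∈ K, act g⁻¹ x ∈ C} := by
  have hcont : Continuous (fun p : OG n × EuclideanSpace ℝ (Fin n) => act p.1⁻¹ p.2) :=
    act_inv_cont
  have h1 : IsCompact ((Set.univ ×ˢ K) ∩ {p : OG n × EuclideanSpace ℝ (Fin n) | act p.1⁻¹ p.2 ∈ C}) :=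
    (isCompact_univ.prod hK).inter_right (hC.preimage hcont)
  have h2 := h1.image continuous_fst
  have : {g : OG n | ∃ x ∈ K, act g⁻¹ x ∈ C} =
      Prod.fst '' ((Set.univ ×ˢ K) ∩ {p : OG n × EuclideanSpace ℝ (Fin n) | act p.1⁻¹ p.2 ∈ C}) := by
    ext g
    simp
  rw [this]
  exact h2.isClosed.measurableSet

/-- Extension of a rotation of `ℝ^d` to `ℝ^n` along an isometric embedding `J`. -/
def iot {n d : ℕ} (J : Matrix (Fin n) (Fin d) ℝ) (hJ : J.transpose * J = 1) (h : OG d) : OG n :=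
  ⟨J * (h : Matrix (Fin d) (Fin d) ℝ) * J.transpose + (1 - J * J.transpose), by
    rw [Matrix.mem_orthogonalGroup_iff]
    have e : ∀ X : Matrix (Fin d) (Fin n) ℝ, J.transpose * (J * X) = X := fun X => by
      rw [← Matrix.mul_assoc, hJ, Matrix.one_mul]
    have e' : ∀ X : Matrix (Fin d) (Fin n) ℝ, (h : Matrix (Fin d) (Fin d) ℝ) *
      ((h : Matrix (Fin d) (Fin d) ℝ).transpose * X) = X := fun X => by
      rw [← Matrix.mul_assoc, OG_mul_tr, Matrix.one_mul]
    simp only [Matrix.transpose_add, Matrix.transpose_sub, Matrix.transpose_mul,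
      Matrix.transpose_transpose, Matrix.transpose_one, Matrix.mul_add, Matrix.add_mul,
      Matrix.mul_sub, Matrix.sub_mul, Matrix.mul_assoc, Matrix.one_mul, Matrix.mul_one, e, e']
    abel⟩

theorem iot_cont {n d : ℕ} (J : Matrix (Fin n) (Fin d) ℝ) (hJ : J.transpose * J = 1) : Continuous (iot J hJ) := by
  refine continuous_induced_rng.2 ?_
  have : Continuous (fun h : OG d => J * (h : Matrix (Fin d) (Fin d) ℝ) * J.transpose + (1 - J * J.transpose)) := by
    fun_prop
  exact this

theorem iot_act_J {n d : ℕ} (J : Matrix (Fin n) (Fin d) ℝ) (hJ : J.transpose * J = 1) (h : OG d)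
    (x : EuclideanSpace ℝ (Fin d)) :
    act (iot J hJ h) (Matrix.toEuclideanLin J x) = Matrix.toEuclideanLin J (act h x) := by
  have : (J * (h : Matrix (Fin d) (Fin d) ℝ) * J.transpose + (1 - J * J.transpose)) * J = J * (h : Matrix (Fin d) (Fin d) ℝ) := by
    rw [Matrix.add_mul, Matrix.sub_mul, Matrix.mul_assoc _ _ J, hJ, Matrix.mul_assoc J _ J, hJ]
    simp
  simp only [act, iot, Matrix.toLpLin_apply, Matrix.mulVec_mulVec, this]

theorem iot_act_perp {n d : ℕ} (J : Matrix (Fin n) (Fin d) ℝ) (hJ : J.transpose * J = 1) (h : OG d)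
    (x : EuclideanSpace ℝ (Fin n)) (hx : J.transpose.mulVec x.ofLp = 0) :
    act (iot J hJ h) x = x := by
  simp only [act, iot, Matrix.toLpLin_apply, Matrix.add_mulVec, Matrix.sub_mulVec, ← Matrix.mulVec_mulVec, hx]
  simp

theorem iot_inv_act_J {n d : ℕ} (J : Matrix (Fin n) (Fin d) ℝ) (hJ : J.transpose * J = 1) (h : OG d)
    (x : EuclideanSpace ℝ (Fin d)) :
    act (iot J hJ h)⁻¹ (Matrix.toEuclideanLin J x) = Matrix.toEuclideanLin J (act h⁻¹ x) := by
  have := iot_act_J J hJ h (act h⁻¹ x)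
  rw [act_act_inv] at this
  rw [← this, act_inv_act]

theorem iot_inv_act_perp {n d : ℕ} (J : Matrix (Fin n) (Fin d) ℝ) (hJ : J.transpose * J = 1) (h : OG d)
    (x : EuclideanSpace ℝ (Fin n)) (hx : J.transpose.mulVec x.ofLp = 0) :
    act (iot J hJ h)⁻¹ x = x := by
  have := iot_act_perp J hJ h x hx
  conv_lhs => rw [← this]
  rw [act_inv_act]

/-- `Ek` as a submodule. -/
def EkS (n k : ℕ) : Submodule ℝ (EuclideanSpace ℝ (Fin n)) where
  carrier := Ek n k
  zero_mem' := fun i _ => rfl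
  add_mem' := fun {x y} hx hy i hi => by simp [hx i hi, hy i hi]
  smul_mem' := fun c x hx i hi => by simp [hx i hi]

theorem mem_EkS {n k : ℕ} (x : EuclideanSpace ℝ (Fin n)) : x ∈ EkS n k ↔ x ∈ Ek n k := Iff.rfl

theorem finrank_EkS {n k : ℕ} (hk : k ≤ n) : Module.finrank ℝ (EkS n k) = k := by
  let f : (Fin k → ℝ) →ₗ[ℝ] EuclideanSpace ℝ (Fin n) :=
    { toFun := fun x => WithLp.toLp 2 fun i => if h : (i : ℕ) < k then x ⟨i, h⟩ else 0
      map_add' := fun x y => by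
        ext i; by_cases h : (i : ℕ) < k <;> simp [h]
      map_smul' := fun c x => by
        ext i; by_cases h : (i : ℕ) < k <;> simp [h] }
  have hinj : Function.Injective f := by
    intro x y hxy
    ext i
    have := congrArg (fun z : EuclideanSpace ℝ (Fin n) => z ⟨i, by omega⟩) hxy
    simpa [f] using this
  have hr : LinearMap.range f = EkS n k := by
    ext x
    constructor
    · rintro ⟨y, rfl⟩ i hi
      simp [f, not_lt.2 hi]
    · intro hx
      refine ⟨fun i => x ⟨i, by omega⟩, ?_⟩
      ext i
      by_cases h : (i : ℕ) < k
      · simp [f, h]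
      · simp [f, h, hx i (not_lt.1 h)]
  rw [← hr, LinearMap.finrank_range_of_inj hinj]
  simp

/-- The random subspace `g E_k`. -/
def Vg {n : ℕ} (k : ℕ) (g : OG n) : Submodule ℝ (EuclideanSpace ℝ (Fin n)) :=
  (EkS n k).map ((actLI g).toLinearEquiv : EuclideanSpace ℝ (Fin n) →ₗ[ℝ] EuclideanSpace ℝ (Fin n))

theorem mem_Vg {n k : ℕ} (g : OG n) (x : EuclideanSpace ℝ (Fin n)) : x ∈ Vg k g ↔ act g⁻¹ x ∈ Ek n k := by
  constructor
  · rintro ⟨y, hy, rfl⟩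
    change act g⁻¹ (act g y) ∈ _
    rw [act_inv_act]; exact hy
  · intro h
    exact ⟨act g⁻¹ x, h, act_act_inv g x⟩

theorem finrank_Vg {n k : ℕ} (hk : k ≤ n) (g : OG n) : Module.finrank ℝ (Vg k g) = k := by
  rw [Vg, LinearEquiv.finrank_map_eq, finrank_EkS hk]

theorem closed_Ek (n k : ℕ) : IsClosed (Ek n k) := (EkS n k).closed_of_finiteDimensional

/-- Embedding of the last `n - j` coordinates. -/
def Jtail (n j : ℕ) : Matrix (Fin n) (Fin (n - j)) ℝ := fun i b => if (i : ℕ) = j + b then 1 else 0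

theorem Jtail_apply (n j : ℕ) (x : EuclideanSpace ℝ (Fin (n - j))) (i : Fin n) :
    (Matrix.toEuclideanLin (Jtail n j) x) i = if h : j ≤ (i : ℕ) then x ⟨i - j, by omega⟩ else 0 := by
  simp only [Matrix.toLpLin_apply, Matrix.mulVec, dotProduct, Jtail, ite_mul, one_mul, zero_mul]
  split_ifs with h
  · rw [Finset.sum_eq_single (⟨i - j, by omega⟩ : Fin (n - j))]
    · rw [if_pos]; simp; omega
    · intro b _ hb
      rw [if_neg]
      intro h'
      exact hb (Fin.ext (by simp; omega))
    · simp
  · exact Finset.sum_eq_zero fun b _ => by rw [if_neg]; omega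

theorem Jtail_iso (n j : ℕ) : (Jtail n j).transpose * Jtail n j = 1 := by
  ext a b
  simp only [Matrix.mul_apply, Matrix.transpose_apply, Jtail, Matrix.one_apply]
  rw [Finset.sum_eq_single (⟨j + a, by omega⟩ : Fin n)]
  · simp [Fin.ext_iff]
  · intro i _ hi
    rw [if_neg, zero_mul]
    intro h; exact hi (Fin.ext h)
  · simp

theorem Jtail_perp (n j : ℕ) (x : EuclideanSpace ℝ (Fin n)) (hx : x ∈ Ek n j) :
    (Jtail n j).transpose.mulVec x.ofLp = 0 := by
  ext a
  simp only [Matrix.mulVec, dotProduct, Matrix.transpose_apply, Jtail]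
  refine Finset.sum_eq_zero fun i _ => ?_
  by_cases h : (i : ℕ) = j + a
  · rw [hx i (by omega), mul_zero]
  · rw [if_neg h, zero_mul]

theorem generic_position (n k : ℕ) (hkn : k < n) (H : Measure (OG n)) [H.IsMulLeftInvariant]
    [IsProbabilityMeasure H] (j : ℕ) (hj : j + k ≤ n) :
    ∀ᵐ g ∂H, ∀ x ∈ Ek n j, act g⁻¹ x ∈ Ek n k → x = 0 := by
  induction j with
  | zero =>
    refine ae_of_all _ fun g x hx _ => ?_
    ext i
    exact hx i (Nat.zero_le _)
  | succ j ih =>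
    have ih := ih (by omega)
    obtain ⟨ν, hν1, hν2⟩ := exists_haar (n - j)
    set B : Set (OG n) := {g | ∃ x ∈ Ek n (j + 1) ∩ Metric.sphere 0 1, act g⁻¹ x ∈ Ek n k} with hB
    have hBm : MeasurableSet B :=
      closed_hit _ _ ((isCompact_sphere 0 1).inter_left (closed_Ek n (j + 1))) (closed_Ek n k)
    have hB0 : H B = 0 := by
      rw [haar_avg H ν (iot (Jtail n j) (Jtail_iso n j)) (iot_cont _ _) B hBm]
      rw [lintegral_eq_zero_iff' ?_]
      swap
      · have hc : Continuous (fun p : OG (n - j) × OG n => iot (Jtail n j) (Jtail_iso n j) p.1 * p.2) :=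
          ((iot_cont _ _).comp continuous_fst).mul continuous_snd
        exact (measurable_measure_prodMk_right (hc.measurable hBm)).aemeasurable
      filter_upwards [ih] with g hg
      set N : Submodule ℝ (EuclideanSpace ℝ (Fin (n - j))) :=
        (Vg k g ⊔ EkS n j).comap (Matrix.toEuclideanLin (Jtail n j)) with hN
      have hNtop : N ≠ ⊤ := by
        intro htop
        have hall : Vg k g ⊔ EkS n j = ⊤ := by
          rw [eq_top_iff]
          intro x _
          set z : EuclideanSpace ℝ (Fin (n - j)) := WithLp.toLp 2 fun b => x ⟨j + b, by omega⟩ with hz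
          have h1 : Matrix.toEuclideanLin (Jtail n j) z ∈ Vg k g ⊔ EkS n j := by
            have : z ∈ N := by rw [htop]; trivial
            exact this
          have h2 : x - Matrix.toEuclideanLin (Jtail n j) z ∈ Vg k g ⊔ EkS n j := by
            apply Submodule.mem_sup_right
            intro i hi
            have e : (⟨j + ((i : ℕ) - j), by omega⟩ : Fin n) = i := Fin.ext (by simp; omega)
            rw [PiLp.sub_apply, Jtail_apply, dif_pos hi]
            simp [hz, e]
          simpa using Submodule.add_mem _ h2 h1
        have h3 := Submodule.finrank_add_le_finrank_add_finrank (Vg k g) (EkS n j)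
        rw [hall, finrank_top, finrank_Vg hkn.le, finrank_EkS (by omega)] at h3
        simp at h3
        omega
      have he0 : (EuclideanSpace.single (⟨0, by omega⟩ : Fin (n - j)) (1 : ℝ)) ≠ 0 := by
        intro h
        simpa using congrArg (fun z : EuclideanSpace ℝ (Fin (n - j)) => z ⟨0, by omega⟩) h
      have hd := haar_direction ν (N : Set (EuclideanSpace ℝ (Fin (n - j))))
        N.closed_of_finiteDimensional.measurableSet (fun c x _ hx => N.smul_mem c hx) _ he0
      rw [gauss_submodule N hNtop] at hd
      refine measure_mono_null ?_ hd
      rintro h ⟨x, ⟨hx, hx1⟩, hxV⟩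
      rw [mul_inv_rev, act_mul] at hxV
      set c := x ⟨j, by omega⟩ with hc
      set y : EuclideanSpace ℝ (Fin n) := x - c • EuclideanSpace.single ⟨j, by omega⟩ 1 with hy
      have hyE : y ∈ Ek n j := by
        intro i hi
        rcases Nat.eq_or_lt_of_le hi with h' | h'
        · have : i = ⟨j, by omega⟩ := Fin.ext h'.symm
          simp [hy, this, hc]
        · have : i ≠ ⟨j, by omega⟩ := fun h => by simp [h] at h'
          simp [hy, this, hx i h']
      have hJe : Matrix.toEuclideanLin (Jtail n j) (EuclideanSpace.single (⟨0, by omega⟩ : Fin (n - j)) (1 : ℝ))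
          = EuclideanSpace.single ⟨j, by omega⟩ 1 := by
        ext i
        rw [Jtail_apply]
        by_cases hi : j ≤ (i : ℕ)
        · rw [dif_pos hi]
          simp only [PiLp.single_apply, Fin.ext_iff]
          congr 1
          simp; omega
        · rw [dif_neg hi]
          simp only [PiLp.single_apply, Fin.ext_iff]
          rw [if_neg]; omega
      have hxy : x = y + c • Matrix.toEuclideanLin (Jtail n j) (EuclideanSpace.single (⟨0, by omega⟩ : Fin (n - j)) (1 : ℝ)) := by
        rw [hJe, hy]; simp
      have hx0 : x ≠ 0 := by
        intro h0; rw [h0] at hx1; simp at hx1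
      have hkey : act (iot (Jtail n j) (Jtail_iso n j) h)⁻¹ x =
          y + c • Matrix.toEuclideanLin (Jtail n j) (act h⁻¹ (EuclideanSpace.single (⟨0, by omega⟩ : Fin (n - j)) (1 : ℝ))) := by
        rw [hxy, act_add, act_smul, iot_inv_act_J, iot_inv_act_perp _ _ _ _ (Jtail_perp n j y hyE)]
      rw [hkey] at hxV
      have hV := (mem_Vg g _).2 hxV
      have hc0 : c ≠ 0 := by
        intro h0
        rw [h0, zero_smul, add_zero] at hxV hxy
        have := hg y hyE hxV
        exact hx0 (hxy.trans this)
      change Matrix.toEuclideanLin (Jtail n j) _ ∈ Vg k g ⊔ EkS n j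
      have hyS : y ∈ Vg k g ⊔ EkS n j := Submodule.mem_sup_right hyE
      have := Submodule.smul_mem _ c⁻¹ (Submodule.sub_mem _ (Submodule.mem_sup_left (T := EkS n j) hV) hyS)
      rwa [add_sub_cancel_left, smul_smul, inv_mul_cancel₀ hc0, one_smul] at this
    have : ∀ᵐ g ∂H, g ∉ B := measure_eq_zero_iff_ae_notMem.1 hB0
    filter_upwards [this] with g hg x hx hxV
    by_contra hx0
    apply hg
    refine ⟨‖x‖⁻¹ • x, ⟨(EkS n (j + 1)).smul_mem _ hx, ?_⟩, ?_⟩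
    · simp [norm_smul, norm_ne_zero_iff.2 hx0]
    · rw [act_smul]
      exact (EkS n k).smul_mem _ hxV

/-- The half-line error function. -/
def qfun (a : ℝ) : ℝ := Real.sqrt (2 / π) * ∫ x in (0 : ℝ)..a, Real.exp (-x ^ 2 / 2)

theorem qfun_cont : Continuous qfun := by
  unfold qfun
  refine continuous_const.mul ?_
  exact intervalIntegral.continuous_primitive (fun a b => Continuous.intervalIntegrable (by fun_prop) a b) 0

theorem qfun_nonneg {a : ℝ} (ha : 0 ≤ a) : 0 ≤ qfun a :=
  mul_nonneg (Real.sqrt_nonneg _) (intervalIntegral.integral_nonneg ha fun _ _ => (Real.exp_pos _).le)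

theorem two_inv_sqrt : 2 * (Real.sqrt (2 * π))⁻¹ = Real.sqrt (2 / π) := by
  have h : Real.sqrt (2 * π) * Real.sqrt (2 / π) = 2 := by
    rw [← Real.sqrt_mul (by positivity), show 2 * π * (2 / π) = 2 ^ 2 by field_simp]
    exact Real.sqrt_sq (by norm_num)
  have h0 : Real.sqrt (2 * π) ≠ 0 := (Real.sqrt_pos.2 (by positivity)).ne'
  field_simp
  linarith

theorem gauss_Icc {a : ℝ} (ha : 0 ≤ a) : gaussianReal 0 1 (Set.Icc (-a) a) = ENNReal.ofReal (qfun a) := by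
  rw [gaussianReal_apply_eq_integral _ (by norm_num)]
  congr 1
  rw [integral_Icc_eq_integral_Ioc, ← intervalIntegral.integral_of_le (by linarith)]
  have hI : ∀ a b : ℝ, IntervalIntegrable (gaussianPDFReal 0 1) volume a b := fun a b =>
    (integrable_gaussianPDFReal 0 1).intervalIntegrable
  rw [← intervalIntegral.integral_add_adjacent_intervals (hI (-a) 0) (hI 0 a)]
  have hneg : ∫ x in (-a)..0, gaussianPDFReal 0 1 x = ∫ x in (0 : ℝ)..a, gaussianPDFReal 0 1 x := by
    have := intervalIntegral.integral_comp_neg (a := 0) (b := a) (gaussianPDFReal 0 1)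
    rw [neg_zero] at this
    rw [← this]
    congr 1
    ext x
    simp [gaussianPDFReal]
  rw [hneg, qfun, ← two_inv_sqrt, ← two_mul]
  simp only [gaussianPDFReal, NNReal.coe_one, mul_one, sub_zero]
  rw [intervalIntegral.integral_const_mul]
  ring

/-- The double cone over the face. -/
def coneS (m k : ℕ) : Set (EuclideanSpace ℝ (Fin (m + 1))) :=
  {w | w (Fin.last m) ≠ 0 ∧ ∀ i : Fin m, Real.sqrt k * |w i.castSucc| ≤ |w (Fin.last m)|}

theorem coneS_meas (m k : ℕ) : MeasurableSet (coneS m k) := by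
  have : coneS m k = {w | w (Fin.last m) ≠ 0} ∩ ⋂ i : Fin m, {w | Real.sqrt k * |w i.castSucc| ≤ |w (Fin.last m)|} := by
    ext w; simp [coneS]
  rw [this]
  refine MeasurableSet.inter ?_ (MeasurableSet.iInter fun i => ?_)
  · exact (isOpen_ne_fun (by fun_prop) continuous_const).measurableSet
  · exact (isClosed_le (by fun_prop) (by fun_prop)).measurableSet

theorem gauss_cone_lintegral (m k : ℕ) (hk : 1 ≤ k) :
    stdGaussian (EuclideanSpace ℝ (Fin (m + 1))) (coneS m k) =
      ∫⁻ t, ENNReal.ofReal (qfun (|t| / Real.sqrt k) ^ m) ∂(gaussianReal 0 1) := by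
  have hk0 : 0 < Real.sqrt k := Real.sqrt_pos.2 (by exact_mod_cast hk)
  rw [← map_pi_eq_stdGaussian, Measure.map_apply (by fun_prop) (coneS_meas m k)]
  have hmp := measurePreserving_piFinSuccAbove (fun _ : Fin (m + 1) => gaussianReal 0 1) (Fin.last m)
  set T : Set (ℝ × (Fin m → ℝ)) := {p | p.1 ≠ 0 ∧ ∀ i : Fin m, Real.sqrt k * |p.2 i| ≤ |p.1|} with hT
  have hTm : MeasurableSet T := by
    have : T = {w | w.1 ≠ 0} ∩ ⋂ i : Fin m, {w | Real.sqrt k * |w.2 i| ≤ |w.1|} := by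
      ext w; simp [T]
    rw [this]
    refine MeasurableSet.inter ?_ (MeasurableSet.iInter fun i => ?_)
    · exact (isOpen_ne_fun (by fun_prop) continuous_const).measurableSet
    · exact (isClosed_le (by fun_prop) (by fun_prop)).measurableSet
  have hpre : WithLp.toLp 2 ⁻¹' coneS m k = MeasurableEquiv.piFinSuccAbove (fun _ : Fin (m + 1) => ℝ) (Fin.last m) ⁻¹' T := by
    ext w
    simp [coneS, T, MeasurableEquiv.piFinSuccAbove, Fin.init]
  rw [hpre, hmp.measure_preimage hTm.nullMeasurableSet, Measure.prod_apply hTm]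
  refine lintegral_congr_ae ?_
  have hne : ∀ᵐ t ∂(gaussianReal 0 1), t ≠ 0 := by
    have := nullSingletonClass_gaussianReal (μ := 0) (v := 1) one_ne_zero
    rw [ae_iff]; simp
  filter_upwards [hne] with t ht
  have : Prod.mk t ⁻¹' T = Set.pi Set.univ fun _ : Fin m => Set.Icc (-(|t| / Real.sqrt k)) (|t| / Real.sqrt k) := by
    ext w
    simp only [T, Set.mem_preimage, Set.mem_ofPred_eq, Set.mem_pi, Set.mem_univ, forall_true_left, Set.mem_Icc, ← abs_le]
    rw [and_iff_right ht]
    refine forall_congr' fun i => ?_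
    rw [le_div_iff₀ hk0, mul_comm]
  rw [this, Measure.pi_pi]
  simp only [Finset.prod_const, Finset.card_univ, Fintype.card_fin]
  rw [gauss_Icc (by positivity), ENNReal.ofReal_pow (qfun_nonneg (by positivity))]

theorem gauss_cone (m k : ℕ) (hk : 1 ≤ k) :
    (stdGaussian (EuclideanSpace ℝ (Fin (m + 1))) (coneS m k)).toReal =
      Real.sqrt (2 * k / π) * ∫ t in Set.Ioi (0 : ℝ), Real.exp (-(k : ℝ) * t ^ 2 / 2) * qfun t ^ m := by
  have hk0 : 0 < Real.sqrt k := Real.sqrt_pos.2 (by exact_mod_cast hk)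
  rw [gauss_cone_lintegral m k hk]
  rw [← integral_eq_lintegral_of_nonneg_ae]
  rotate_left
  · exact ae_of_all _ fun t => pow_nonneg (qfun_nonneg (by positivity)) _
  · refine Continuous.aestronglyMeasurable ?_
    exact (qfun_cont.comp (by fun_prop)).pow m
  rw [integral_gaussianReal_eq_integral_smul one_ne_zero]
  have e1 : ∀ t : ℝ, gaussianPDFReal 0 1 t • qfun (|t| / Real.sqrt k) ^ m =
      (fun s => (Real.sqrt (2 * π))⁻¹ * (Real.exp (-s ^ 2 / 2) * qfun (s / Real.sqrt k) ^ m)) |t| := by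
    intro t
    simp [gaussianPDFReal, mul_assoc]
  rw [integral_congr_ae (ae_of_all _ e1), integral_comp_abs (f := fun s => (Real.sqrt (2 * π))⁻¹ * (Real.exp (-s ^ 2 / 2) * qfun (s / Real.sqrt k) ^ m)), integral_const_mul, ← mul_assoc, two_inv_sqrt]
  have e2 := integral_comp_mul_left_Ioi (fun s => Real.exp (-s ^ 2 / 2) * qfun (s / Real.sqrt k) ^ m) 0 hk0
  rw [mul_zero] at e2
  have e3 : ∀ s : ℝ, Real.exp (-(Real.sqrt k * s) ^ 2 / 2) * qfun (Real.sqrt k * s / Real.sqrt k) ^ m =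
      Real.exp (-(k : ℝ) * s ^ 2 / 2) * qfun s ^ m := by
    intro s
    rw [mul_div_cancel_left₀ _ hk0.ne', mul_pow, Real.sq_sqrt (by positivity), neg_mul]
  simp_rw [e3] at e2
  rw [e2, show 2 * (k : ℝ) / π = 2 / π * k by ring, Real.sqrt_mul (by positivity), smul_eq_mul]
  field_simp

/-- Isometric embedding of `ℝ^{m+1}` onto the span of the face. -/
def Jface (m k : ℕ) : Matrix (Fin (m + k)) (Fin (m + 1)) ℝ := fun i b =>
  Fin.addCases (motive := fun _ => ℝ) (fun i' => if b = i'.castSucc then 1 else 0)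
    (fun _ => if b = Fin.last m then (Real.sqrt k)⁻¹ else 0) i

theorem Jface_left (m k : ℕ) (i : Fin m) (b : Fin (m + 1)) :
    Jface m k (Fin.castAdd k i) b = if b = i.castSucc then 1 else 0 := by
  simp [Jface]

theorem Jface_right (m k : ℕ) (i : Fin k) (b : Fin (m + 1)) :
    Jface m k (Fin.natAdd m i) b = if b = Fin.last m then (Real.sqrt k)⁻¹ else 0 := by
  simp [Jface]

theorem Jface_apply_left (m k : ℕ) (x : EuclideanSpace ℝ (Fin (m + 1))) (i : Fin m) :
    (Matrix.toEuclideanLin (Jface m k) x) (Fin.castAdd k i) = x i.castSucc := by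
  simp [Matrix.toLpLin_apply, Matrix.mulVec, dotProduct, Jface_left]

theorem Jface_apply_right (m k : ℕ) (x : EuclideanSpace ℝ (Fin (m + 1))) (i : Fin k) :
    (Matrix.toEuclideanLin (Jface m k) x) (Fin.natAdd m i) = (Real.sqrt k)⁻¹ * x (Fin.last m) := by
  simp [Matrix.toLpLin_apply, Matrix.mulVec, dotProduct, Jface_right]

theorem Jface_iso (m k : ℕ) (hk : 1 ≤ k) : (Jface m k).transpose * Jface m k = 1 := by
  have hk1 : (1 : ℝ) ≤ k := by exact_mod_cast hk
  have hkk : (k : ℝ) * ((Real.sqrt k)⁻¹ * (Real.sqrt k)⁻¹) = 1 := by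
    rw [← mul_inv, Real.mul_self_sqrt (by positivity)]
    exact mul_inv_cancel₀ (by positivity)
  ext a b
  simp only [Matrix.mul_apply, Matrix.transpose_apply, Fin.sum_univ_add, Jface_left, Jface_right,
    Matrix.one_apply]
  refine Fin.lastCases ?_ (fun a => ?_) a <;> refine Fin.lastCases ?_ (fun b => ?_) b
  · simp [(Fin.castSucc_ne_last _).symm, hkk]
  · simp [(Fin.castSucc_ne_last _).symm]
  · simp [(Fin.castSucc_ne_last _).symm]
  · simp [eq_comm]

theorem Jface_inj (m k : ℕ) (hk : 1 ≤ k) : Function.Injective (Matrix.toEuclideanLin (Jface m k)) := by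
  intro x y hxy
  have h : ∀ z : EuclideanSpace ℝ (Fin (m + 1)), Matrix.toEuclideanLin (Jface m k).transpose
      (Matrix.toEuclideanLin (Jface m k) z) = z := fun z => by
    simp [Matrix.toLpLin_apply, Jface_iso m k hk]
  rw [← h x, hxy, h y]

/-- The face in the coordinates of its span. -/
def faceF (m k : ℕ) : Set (EuclideanSpace ℝ (Fin (m + 1))) :=
  {f | (∀ i : Fin m, |f i.castSucc| ≤ 1) ∧ f (Fin.last m) = Real.sqrt k}

theorem cubeFace_eq (m k : ℕ) (hk : 1 ≤ k) :
    cubeFace (m + k) m = Matrix.toEuclideanLin (Jface m k) '' faceF m k := by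
  have hk0 : 0 < Real.sqrt k := Real.sqrt_pos.2 (by exact_mod_cast hk)
  ext x
  constructor
  · rintro ⟨h1, h2⟩
    refine ⟨WithLp.toLp 2 (Fin.snoc (α := fun _ => ℝ) (fun i : Fin m => x (Fin.castAdd k i)) (Real.sqrt k)), ⟨?_, ?_⟩, ?_⟩
    · intro i
      simpa using h1 (Fin.castAdd k i) (by simp)
    · simp
    · ext i
      refine Fin.addCases (fun i => ?_) (fun i => ?_) i
      · rw [Jface_apply_left]; simp
      · rw [Jface_apply_right, h2 _ (by simp)]; simp [hk0.ne']
  · rintro ⟨f, ⟨h1, h2⟩, rfl⟩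
    refine ⟨fun i => ?_, fun i => ?_⟩
    · refine Fin.addCases (fun i _ => ?_) (fun i hi => ?_) i
      · rw [Jface_apply_left]; exact h1 i
      · simp at hi
    · refine Fin.addCases (fun i hi => ?_) (fun i _ => ?_) i
      · simp at hi; omega
      · rw [Jface_apply_right, h2, inv_mul_cancel₀ hk0.ne']

theorem cone_iff (m k : ℕ) (hk : 1 ≤ k) (w : EuclideanSpace ℝ (Fin (m + 1))) :
    w ∈ coneS m k ↔ ∃ c : ℝ, c • w ∈ faceF m k := by
  have hk0 : 0 < Real.sqrt k := Real.sqrt_pos.2 (by exact_mod_cast hk)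
  constructor
  · rintro ⟨h0, h1⟩
    refine ⟨Real.sqrt k / w (Fin.last m), fun i => ?_, ?_⟩
    · rw [PiLp.smul_apply, smul_eq_mul, abs_mul, abs_div, abs_of_pos hk0, div_mul_eq_mul_div,
        div_le_one (abs_pos.2 h0)]
      exact h1 i
    · rw [PiLp.smul_apply, smul_eq_mul, div_mul_cancel₀ _ h0]
  · rintro ⟨c, h1, h2⟩
    rw [PiLp.smul_apply, smul_eq_mul] at h2
    have hc : c ≠ 0 := by rintro rfl; rw [zero_mul] at h2; exact hk0.ne h2
    refine ⟨fun h => by rw [h, mul_zero] at h2; exact hk0.ne h2, fun i => ?_⟩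
    have := h1 i
    rw [PiLp.smul_apply, smul_eq_mul, abs_mul] at this
    rw [← abs_of_pos hk0, ← h2, abs_mul, mul_right_comm]
    exact mul_le_of_le_one_left (abs_nonneg _) this

theorem hit_prob (m k : ℕ) (hk : 1 ≤ k) (hm : 1 ≤ m) (H : Measure (OG (m + k))) [H.IsMulLeftInvariant]
    [IsProbabilityMeasure H] :
    H {g | (act g '' Ek (m + k) k ∩ cubeFace (m + k) m).Nonempty} =
      stdGaussian (EuclideanSpace ℝ (Fin (m + 1))) (coneS m k) := by
  have hk0 : 0 < Real.sqrt k := Real.sqrt_pos.2 (by exact_mod_cast hk)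
  have hA : {g : OG (m + k) | (act g '' Ek (m + k) k ∩ cubeFace (m + k) m).Nonempty} =
      {g | ∃ x ∈ cubeFace (m + k) m, act g⁻¹ x ∈ Ek (m + k) k} := by
    ext g
    constructor
    · rintro ⟨_, ⟨y, hy, rfl⟩, hx⟩
      exact ⟨act g y, hx, by rw [act_inv_act]; exact hy⟩
    · rintro ⟨x, hx, hxV⟩
      exact ⟨x, ⟨_, hxV, act_act_inv g x⟩, hx⟩
  rw [hA]
  have hcpt : IsCompact (cubeFace (m + k) m) := by
    have h1 : IsCompact (Set.pi Set.univ fun _ : Fin (m + k) => Set.Icc (-1 : ℝ) 1) :=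
      isCompact_univ_pi fun _ => isCompact_Icc
    have h2 := h1.image (PiLp.continuous_toLp 2 (fun _ : Fin (m + k) => ℝ))
    refine h2.of_isClosed_subset ?_ ?_
    · have : cubeFace (m + k) m = (⋂ i : Fin (m + k), ⋂ _ : (i : ℕ) < m, {x | |x i| ≤ 1}) ∩
          ⋂ i : Fin (m + k), ⋂ _ : m ≤ (i : ℕ), {x | x i = 1} := by
        ext x; simp [cubeFace]
      rw [this]
      refine IsClosed.inter (isClosed_iInter fun i => isClosed_iInter fun _ => ?_)
        (isClosed_iInter fun i => isClosed_iInter fun _ => ?_)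
      · exact isClosed_le (by fun_prop) continuous_const
      · exact isClosed_eq (by fun_prop) continuous_const
    · rintro x ⟨h3, h4⟩
      refine ⟨x.ofLp, fun i _ => ?_, rfl⟩
      rcases lt_or_ge (i : ℕ) m with h | h
      · exact abs_le.1 (h3 i h)
      · rw [h4 i h]; norm_num
  obtain ⟨ν, hν1, hν2⟩ := exists_haar (m + 1)
  have hJ := Jface_iso m k hk
  have hσ : Continuous (fun h : OG (m + 1) => (iot (Jface m k) hJ h)⁻¹) :=
    Continuous.comp (g := fun g : OG (m + k) => g⁻¹) continuous_inv (iot_cont _ hJ)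
  rw [haar_avg H ν _ hσ _ (closed_hit _ _ hcpt (closed_Ek _ _))]
  have hgen := generic_position (m + k) k (by omega) H m le_rfl
  have hae : ∀ᵐ g ∂H, ν {h | (iot (Jface m k) hJ h)⁻¹ * g ∈
      {g : OG (m + k) | ∃ x ∈ cubeFace (m + k) m, act g⁻¹ x ∈ Ek (m + k) k}} =
      stdGaussian (EuclideanSpace ℝ (Fin (m + 1))) (coneS m k) := by
    filter_upwards [hgen] with g hg
    set W : Submodule ℝ (EuclideanSpace ℝ (Fin (m + 1))) := (Vg k g).comap (Matrix.toEuclideanLin (Jface m k)) with hW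
    -- existence of a nonzero vector
    have hex : ∃ v ∈ W, v ≠ 0 := by
      by_contra hno
      push Not at hno
      have hdisj : Disjoint (Vg k g) (LinearMap.range (Matrix.toEuclideanLin (Jface m k))) := by
        rw [Submodule.disjoint_def]
        rintro _ hx ⟨v, rfl⟩
        rw [hno v hx, map_zero]
      have h1 := Submodule.finrank_add_finrank_le_of_disjoint hdisj
      rw [finrank_Vg (by omega), LinearMap.finrank_range_of_inj (Jface_inj m k hk)] at h1
      simp at h1
      omega
    obtain ⟨v, hvW, hv0⟩ := hex
    have hzero : ∀ w ∈ W, w (Fin.last m) = 0 → w = 0 := by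
      intro w hw h0
      have := hg (Matrix.toEuclideanLin (Jface m k) w) (by
        intro i
        refine Fin.addCases (fun i hi => ?_) (fun i _ => ?_) i
        · simp at hi; omega
        · rw [Jface_apply_right, h0, mul_zero]) ((mem_Vg g _).1 hw)
      exact Jface_inj m k hk (by rw [this, map_zero])
    have hvl : v (Fin.last m) ≠ 0 := fun h => hv0 (hzero v hvW h)
    have hspan : ∀ w ∈ W, ∃ c : ℝ, w = c • v := by
      intro w hw
      refine ⟨w (Fin.last m) / v (Fin.last m), ?_⟩
      rw [← sub_eq_zero]
      apply hzero _ (W.sub_mem hw (W.smul_mem _ hvW))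
      simp [hvl]
    rw [← haar_direction ν (coneS m k) (coneS_meas m k) ?_ v hv0]
    · congr 1
      ext h
      simp only [Set.mem_ofPred_eq]
      rw [cone_iff m k hk, cubeFace_eq m k hk]
      constructor
      · rintro ⟨_, ⟨f, hf, rfl⟩, hx⟩
        rw [mul_inv_rev, inv_inv, act_mul, iot_act_J] at hx
        obtain ⟨c, hc⟩ := hspan (act h f) ((mem_Vg g _).2 hx)
        refine ⟨c, ?_⟩
        rw [← act_smul, ← hc, act_inv_act]
        exact hf
      · rintro ⟨c, hc⟩
        refine ⟨_, ⟨_, hc, rfl⟩, ?_⟩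
        rw [mul_inv_rev, inv_inv, act_mul, iot_act_J, act_smul, act_act_inv]
        exact (mem_Vg g _).1 (W.smul_mem c hvW)
    · intro c x hc hx
      rw [cone_iff m k hk] at hx ⊢
      obtain ⟨a, ha⟩ := hx
      refine ⟨a * c⁻¹, ?_⟩
      rwa [smul_smul, mul_assoc, inv_mul_cancel₀ hc, mul_one]
  rw [lintegral_congr_ae hae, lintegral_const, measure_univ, mul_one]

/-- `f(0,k,n) = 2^k · C(n,k) · √(2k/π) · ∫₀^∞ e^{-kt²/2} (√(2/π)∫₀^t e^{-x²/2}dx)^{n-k} dt`. -/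
theorem expected_vertices_formula (n k : ℕ) (hk : 1 ≤ k) (hkn : k < n)
    (H : Measure (OG n)) [H.IsHaarMeasure] [IsProbabilityMeasure H] :
    expFaces n H 0 k =
      2 ^ k * (n.choose k) * Real.sqrt (2 * k / π) *
        ∫ t in Set.Ioi (0 : ℝ),
          Real.exp (-(k : ℝ) * t ^ 2 / 2) *
            (Real.sqrt (2 / π) * ∫ x in (0 : ℝ)..t, Real.exp (-x ^ 2 / 2)) ^ (n - k) := by

  obtain ⟨m, rfl⟩ : ∃ m, n = m + k := ⟨n - k, by omega⟩
  have hm : 1 ≤ m := by omega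
  have h1 := hit_prob m k hk hm H
  have h2 := gauss_cone m k hk
  simp only [qfun] at h2
  simp only [expFaces, Nat.sub_zero, Nat.add_zero, Nat.add_sub_cancel]
  rw [h1, h2]
  ring
end
end

section
/- Suppose {α_n}_{n=1}^∞ is a sequence of real numbers with a positive limit α. Then, as n → ∞, ∫_0^∞ e^{-α_n t²/2} γ_n(t Q^n) dt ∼ Γ(α) · (π^{α/2}/√2) · (log n)^{(α_n−1)/2} / n^{α_n}; that is, the ratio of the two sides tends to 1, where Γ is the Gamma function. -/
open MeasureTheory Real Filter

noncomputable section

/-- The function `t ↦ γ₁([-t,t])`. -/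
def FF (t : ℝ) : ℝ := Real.sqrt (2 / π) * ∫ x in (0 : ℝ)..t, Real.exp (-x ^ 2 / 2)

lemma gauss_int : Integrable (fun x : ℝ => Real.exp (-x ^ 2 / 2)) := by
  have := integrable_exp_neg_mul_sq (b := 1/2) (by norm_num)
  refine this.congr (Eventually.of_forall fun x => ?_)
  simp only
  congr 1
  ring

lemma FF_eq (t : ℝ) :
    FF t = 1 - Real.sqrt (2 / π) * ∫ x in Set.Ioi t, Real.exp (-x ^ 2 / 2) := by
  have h1 := intervalIntegral.integral_interval_add_Ioi (a := 0) (b := t)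
    gauss_int.integrableOn gauss_int.integrableOn
  have h2 : ∫ x in Set.Ioi (0:ℝ), Real.exp (-x ^ 2 / 2) = √(π / (1/2)) / 2 := by
    rw [← integral_gaussian_Ioi]
    congr 1
    ext x
    congr 1
    ring
  have h3 : √(2 / π) * (√(π / (1/2)) / 2) = 1 := by
    rw [← mul_div_assoc, ← Real.sqrt_mul (by positivity)]
    have : 2 / π * (π / (1/2)) = 2 ^ 2 := by
      field_simp
    rw [this, Real.sqrt_sq (by norm_num)]
    norm_num
  unfold FF
  rw [h2] at h1
  rw [← h3, ← h1]
  ring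

lemma FF_cont : Continuous FF := by
  unfold FF
  refine continuous_const.mul ?_
  exact intervalIntegral.continuous_primitive (fun a b => gauss_int.intervalIntegrable) 0

lemma FF_nonneg {t : ℝ} (ht : 0 ≤ t) : 0 ≤ FF t := by
  unfold FF
  refine mul_nonneg (by positivity) ?_
  exact intervalIntegral.integral_nonneg ht (fun x _ => (Real.exp_pos _).le)

lemma cov (g : ℝ → ℝ) {c : ℝ} (hc : 0 < c) (u : ℝ) :
    ∫ x in Set.Ioi (c + u / c), g x = (1 / c) * ∫ s in Set.Ioi u, g (c + s / c) := by
  rw [← integral_indicator measurableSet_Ioi, ← integral_indicator measurableSet_Ioi]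
  have h : (fun s => Set.indicator (Set.Ioi u) (fun s => g (c + s / c)) s)
      = fun s => (fun y => (Set.Ioi (c + u / c)).indicator g (c + y)) (s / c) := by
    ext s
    beta_reduce
    by_cases h : u < s
    · rw [Set.indicator_of_mem (by exact h), Set.indicator_of_mem]
      simp only [Set.mem_Ioi]
      gcongr
    · rw [Set.indicator_of_notMem (by exact h), Set.indicator_of_notMem]
      simp only [Set.mem_Ioi, not_lt] at *
      gcongr
  rw [h, Measure.integral_comp_div (fun y => (Set.Ioi (c + u / c)).indicator g (c + y)),
    integral_add_left_eq_self (fun y => (Set.Ioi (c + u / c)).indicator g y), abs_of_pos hc,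
    smul_eq_mul]
  field_simp

/-- rescaled tail -/
def TT (c s : ℝ) : ℝ := ∫ y in Set.Ioi s, Real.exp (-y - y ^ 2 / (2 * c ^ 2))

lemma one_sub_FF {c : ℝ} (hc : 0 < c) (s : ℝ) :
    FF (c + s / c) = 1 - √(2 / π) * (Real.exp (-c ^ 2 / 2) / c * TT c s) := by
  rw [FF_eq, cov _ hc, TT]
  have : ∀ y : ℝ, Real.exp (-(c + y / c) ^ 2 / 2)
      = Real.exp (-c ^ 2 / 2) * Real.exp (-y - y ^ 2 / (2 * c ^ 2)) := by
    intro y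
    rw [← Real.exp_add]
    congr 1
    field_simp
    ring
  simp_rw [this]
  rw [integral_const_mul]
  ring

lemma TT_int (c s : ℝ) :
    IntegrableOn (fun y => Real.exp (-y - y ^ 2 / (2 * c ^ 2))) (Set.Ioi s) := by
  have h := exp_neg_integrableOn_Ioi s (b := 1) one_pos
  refine Integrable.mono' h ?_ (Eventually.of_forall fun y => ?_)
  · exact Continuous.aestronglyMeasurable (by fun_prop)
  · rw [Real.norm_eq_abs, Real.abs_exp]
    apply Real.exp_le_exp.2
    have : 0 ≤ y ^ 2 / (2 * c ^ 2) := by positivity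
    linarith

lemma TT_nonneg (c s : ℝ) : 0 ≤ TT c s :=
  integral_nonneg fun y => (Real.exp_pos _).le

lemma TT_lower {c s : ℝ} (hc : 1 ≤ c) (hs : -c ^ 2 ≤ s) (hs0 : s ≤ 0) :
    Real.exp (-2) * Real.exp (-s / 2) ≤ TT c s := by
  have h1 : ∫ y in Set.Ioc s (s + 1), Real.exp (-2) * Real.exp (-s / 2) ≤
      ∫ y in Set.Ioc s (s + 1), Real.exp (-y - y ^ 2 / (2 * c ^ 2)) := by
    refine setIntegral_mono_on ?_ ?_ measurableSet_Ioc ?_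
    · exact integrableOn_const (by simp)
    · exact (TT_int c s).mono_set Set.Ioc_subset_Ioi_self
    · intro y hy
      rw [← Real.exp_add]
      apply Real.exp_le_exp.2
      have hc2 : 1 ≤ c ^ 2 := one_le_pow₀ hc
      have hc0 : 0 < 2 * c ^ 2 := by linarith
      have : y ^ 2 / (2 * c ^ 2) ≤ -s / 2 + 1 / 2 := by
        rw [div_le_iff₀ hc0]
        obtain ⟨hy1, hy2⟩ := hy
        have : y ^ 2 ≤ s ^ 2 + 1 := by nlinarith
        nlinarith
      linarith [hy.2]
  have h2 : ∫ y in Set.Ioc s (s + 1), Real.exp (-y - y ^ 2 / (2 * c ^ 2)) ≤ TT c s :=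
    setIntegral_mono_set (TT_int c s) (Eventually.of_forall fun y => (Real.exp_pos _).le)
      (Set.Ioc_subset_Ioi_self.eventuallyLE)
  have h3 : ∫ y in Set.Ioc s (s + 1), Real.exp (-2) * Real.exp (-s / 2)
      = Real.exp (-2) * Real.exp (-s / 2) := by
    simp
  linarith

lemma TT_tendsto {c : ℕ → ℝ} (hc : Tendsto c atTop atTop) (s : ℝ) :
    Tendsto (fun n => TT (c n) s) atTop (nhds (Real.exp (-s))) := by
  rw [← integral_exp_neg_Ioi]
  unfold TT
  refine tendsto_integral_filter_of_dominated_convergence (fun y => Real.exp (-1 * y)) ?_ ?_ ?_ ?_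
  · exact Eventually.of_forall fun n => Continuous.aestronglyMeasurable (by fun_prop)
  · refine Eventually.of_forall fun n => Eventually.of_forall fun y => ?_
    rw [Real.norm_eq_abs, Real.abs_exp]
    apply Real.exp_le_exp.2
    have : 0 ≤ y ^ 2 / (2 * c n ^ 2) := by positivity
    linarith
  · exact exp_neg_integrableOn_Ioi s (b := 1) one_pos
  · refine Eventually.of_forall fun y => ?_
    refine (Real.continuous_exp.tendsto _).comp ?_
    have : Tendsto (fun n => y ^ 2 / (2 * c n ^ 2)) atTop (nhds 0) := by
      refine Tendsto.div_atTop tendsto_const_nhds ?_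
      exact Tendsto.const_mul_atTop two_pos ((tendsto_pow_atTop two_ne_zero).comp hc)
    simpa using tendsto_const_nhds.sub this

lemma bound_int {b : ℝ} (hb : 0 < b) : Integrable (fun s : ℝ => Real.exp (-b * |s|)) := by
  rw [← integrableOn_univ, ← Set.Iic_union_Ioi (a := (0:ℝ))]
  refine IntegrableOn.union ?_ ?_
  · refine (integrableOn_exp_mul_Iic hb 0).congr_fun (fun x hx => ?_) measurableSet_Iic
    simp only [Set.mem_Iic] at hx
    simp only [abs_of_nonpos hx]
    congr 1
    ring
  · refine (exp_neg_integrableOn_Ioi 0 hb).congr_fun (fun x hx => ?_) measurableSet_Ioi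
    simp only [abs_of_pos (show 0 < x from hx)]

lemma final_int {a κ : ℝ} (ha : 0 < a) (hκ : 0 < κ) :
    ∫ s : ℝ, Real.exp (-a * s) * Real.exp (-(κ * Real.exp (-s))) = (1 / κ) ^ a * Real.Gamma a := by
  rw [← Real.integral_rpow_mul_exp_neg_mul_Ioi ha hκ]
  have himg : (fun s : ℝ => Real.exp (-s)) '' Set.univ = Set.Ioi 0 := by
    ext x
    simp only [Set.image_univ, Set.mem_range, Set.mem_Ioi]
    constructor
    · rintro ⟨y, rfl⟩
      exact Real.exp_pos _
    · intro hx
      exact ⟨-Real.log x, by simp [Real.exp_log hx]⟩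
  rw [← himg, integral_image_eq_integral_abs_deriv_smul (f' := fun s => -Real.exp (-s))
    MeasurableSet.univ ?_ ?_, setIntegral_univ]
  · congr 1
    ext s
    rw [abs_neg, Real.abs_exp, smul_eq_mul, ← Real.exp_mul]
    simp only [← Real.exp_add]
    congr 1
    ring
  · intro x _
    have := ((hasDerivAt_id x).neg).exp.hasDerivWithinAt (s := Set.univ)
    simpa using this
  · intro x _ y _ h
    simpa using h

/-- the rescaled integral -/
lemma rescale (A : ℝ) (n : ℕ) {c : ℝ} (hc : 0 < c) :
    (∫ t in Set.Ioi (0 : ℝ), Real.exp (-A * t ^ 2 / 2) * FF t ^ n) =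
      Real.exp (-A * c ^ 2 / 2) / c *
        ∫ s, (Set.Ioi (-c ^ 2)).indicator
          (fun s => Real.exp (-A * s - A * s ^ 2 / (2 * c ^ 2)) * FF (c + s / c) ^ n) s := by
  have h0 : c + (-c ^ 2) / c = 0 := by
    field_simp
    ring
  have h := cov (fun t => Real.exp (-A * t ^ 2 / 2) * FF t ^ n) hc (-c ^ 2)
  rw [h0] at h
  rw [h, integral_indicator measurableSet_Ioi]
  have : ∀ s : ℝ, Real.exp (-A * (c + s / c) ^ 2 / 2) * FF (c + s / c) ^ n
      = Real.exp (-A * c ^ 2 / 2) *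
        (Real.exp (-A * s - A * s ^ 2 / (2 * c ^ 2)) * FF (c + s / c) ^ n) := by
    intro s
    rw [← mul_assoc, ← Real.exp_add]
    congr 2
    field_simp
    ring
  simp_rw [this]
  rw [integral_const_mul]
  ring

lemma exp_exp_bound {K : ℝ} (hK : 0 < K) (k : ℕ) (r : ℝ) :
    Real.exp (-(K * Real.exp (r / 2))) ≤ (k.factorial / K ^ k) * Real.exp (-(k * r / 2)) := by
  have h := Real.pow_div_factorial_le_exp (K * Real.exp (r / 2)) (by positivity) k
  rw [Real.exp_neg]
  have hp : 0 < (K * Real.exp (r / 2)) ^ k / k.factorial := by positivity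
  refine (inv_anti₀ hp h).trans (le_of_eq ?_)
  rw [mul_pow, ← Real.exp_nat_mul, Real.exp_neg, mul_div_assoc]
  field_simp

theorem main_tendsto {α c : ℕ → ℝ} {a κ : ℝ} (ha : 0 < a) (hα : Tendsto α atTop (nhds a))
    (hκ : 0 < κ) (hc : Tendsto c atTop atTop)
    (hcκ : Tendsto (fun n : ℕ => √(2 / π) * (n * Real.exp (-c n ^ 2 / 2) / c n)) atTop (nhds κ)) :
    Tendsto (fun n : ℕ => ∫ s, (Set.Ioi (-c n ^ 2)).indicator
          (fun s => Real.exp (-α n * s - α n * s ^ 2 / (2 * c n ^ 2)) * FF (c n + s / c n) ^ n) s)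
      atTop (nhds ((1 / κ) ^ a * Real.Gamma a)) := by
  rw [← final_int ha hκ]
  obtain ⟨k, hk⟩ := exists_nat_ge (2 * (2 * a + 1))
  set K := κ / 2 * Real.exp (-2) with hKdef
  have hK : 0 < K := by positivity
  set b := min (a / 2) 1 with hb
  have hb0 : 0 < b := by positivity
  set C := max 1 (k.factorial / K ^ k) with hC
  have e1 : ∀ᶠ n in atTop, 1 ≤ c n := hc.eventually_ge_atTop 1
  have e2 : ∀ᶠ n in atTop, a / 2 < α n := hα.eventually_const_lt (by linarith)
  have e3 : ∀ᶠ n in atTop, α n < 2 * a := hα.eventually_lt_const (by linarith)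
  have e4 := hcκ.eventually_const_lt (show κ / 2 < κ by linarith)
  refine tendsto_integral_filter_of_dominated_convergence (fun s => C * Real.exp (-b * |s|))
    ?_ ?_ ((bound_int hb0).const_mul C) ?_
  · refine Eventually.of_forall fun n => ?_
    refine AEStronglyMeasurable.indicator ?_ measurableSet_Ioi
    refine Continuous.aestronglyMeasurable ?_
    have := FF_cont
    fun_prop
  · filter_upwards [e1, e2, e3, e4] with n h1 h2 h3 h4
    refine Eventually.of_forall fun s => ?_
    have hc0 : 0 < c n := by linarith
    by_cases hs : s ∈ Set.Ioi (-c n ^ 2)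
    swap
    · rw [Set.indicator_of_notMem hs, norm_zero]
      positivity
    rw [Set.indicator_of_mem hs]
    simp only [Set.mem_Ioi] at hs
    have ht : 0 ≤ c n + s / c n := by
      have : c n + s / c n = (c n ^ 2 + s) / c n := by
        field_simp
      rw [this]
      apply div_nonneg _ hc0.le
      linarith
    have hF0 := FF_nonneg ht
    have hFle : FF (c n + s / c n) ^ n ≤
        Real.exp (-(√(2 / π) * (n * Real.exp (-c n ^ 2 / 2) / c n) * TT (c n) s)) := by
      have : FF (c n + s / c n) ≤
          Real.exp (-(√(2 / π) * (Real.exp (-c n ^ 2 / 2) / c n * TT (c n) s))) := by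
        rw [one_sub_FF hc0]
        exact Real.one_sub_le_exp_neg _
      refine (pow_le_pow_left₀ hF0 this n).trans (le_of_eq ?_)
      rw [← Real.exp_nat_mul]
      congr 1
      ring
    rw [norm_mul, Real.norm_eq_abs, Real.abs_exp, Real.norm_eq_abs, abs_of_nonneg (by positivity)]
    have hα0 : 0 < α n := by linarith
    have hq : 0 ≤ α n * s ^ 2 / (2 * c n ^ 2) := by positivity
    rcases le_or_gt 0 s with h0 | h0
    · rw [abs_of_nonneg h0]
      have hF1 : FF (c n + s / c n) ^ n ≤ 1 := by
        refine hFle.trans ?_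
        rw [Real.exp_le_one_iff]
        have := TT_nonneg (c n) s
        have : 0 < √(2 / π) * (n * Real.exp (-c n ^ 2 / 2) / c n) := by linarith
        have : 0 ≤ √(2 / π) * (n * Real.exp (-c n ^ 2 / 2) / c n) * TT (c n) s := by positivity
        linarith
      have hE : Real.exp (-α n * s - α n * s ^ 2 / (2 * c n ^ 2)) ≤ Real.exp (-b * s) := by
        apply Real.exp_le_exp.2
        have : b ≤ a / 2 := min_le_left _ _
        nlinarith
      calc _ ≤ Real.exp (-b * s) * 1 := by gcongr
        _ = 1 * Real.exp (-b * s) := by ring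
        _ ≤ _ := by
          gcongr
          exact le_max_left _ _
    · rw [abs_of_neg h0]
      have hT := TT_lower h1 hs.le h0.le
      have hF2 : FF (c n + s / c n) ^ n ≤ C * Real.exp (-(k * (-s) / 2)) := by
        refine hFle.trans ?_
        have hx := exp_exp_bound hK k (-s)
        calc _ ≤ Real.exp (-(K * Real.exp (-s / 2))) := by
              apply Real.exp_le_exp.2
              rw [hKdef, neg_le_neg_iff, mul_assoc]
              gcongr
          _ ≤ _ := hx
          _ ≤ _ := by
            gcongr
            exact le_max_right _ _
      have hE : Real.exp (-α n * s - α n * s ^ 2 / (2 * c n ^ 2)) ≤ Real.exp (-(2 * a) * s) := by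
        apply Real.exp_le_exp.2
        nlinarith
      calc _ ≤ Real.exp (-(2 * a) * s) * (C * Real.exp (-(k * (-s) / 2))) := by gcongr
        _ = C * Real.exp (-(2 * a) * s + -(k * (-s) / 2)) := by
          rw [Real.exp_add]
          ring
        _ ≤ _ := by
          gcongr
          have : b ≤ 1 := min_le_right _ _
          nlinarith
  · refine Eventually.of_forall fun s => ?_
    have e5 : ∀ᶠ n in atTop, -s < c n ^ 2 :=
      ((tendsto_pow_atTop two_ne_zero).comp hc).eventually_gt_atTop (-s)
    have hlim : Tendsto (fun n => Real.exp (-α n * s - α n * s ^ 2 / (2 * c n ^ 2)) *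
        (1 + -(√(2 / π) * (Real.exp (-c n ^ 2 / 2) / c n * TT (c n) s))) ^ n) atTop
        (nhds (Real.exp (-a * s) * Real.exp (-(κ * Real.exp (-s))))) := by
      refine Tendsto.mul ?_ ?_
      · refine (Real.continuous_exp.tendsto _).comp ?_
        have : Tendsto (fun n => α n * s ^ 2 / (2 * c n ^ 2)) atTop (nhds 0) := by
          refine Tendsto.div_atTop (hα.mul_const _) ?_
          exact Tendsto.const_mul_atTop two_pos ((tendsto_pow_atTop two_ne_zero).comp hc)
        simpa using (hα.neg.mul_const s).sub this
      · apply Real.tendsto_one_add_pow_exp_of_tendsto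
        refine ((hcκ.mul (TT_tendsto hc s)).neg).congr fun n => ?_
        ring
    refine hlim.congr' ?_
    filter_upwards [e1, e5] with n h1 h5
    rw [Set.indicator_of_mem (by simp only [Set.mem_Ioi]; linarith), one_sub_FF (by linarith)]
    ring_nf

/-- if `αₙ → α > 0`, then
`∫₀^∞ e^{-αₙ t²/2} γₙ(tQⁿ) dt ∼ Γ(α) (π^{α/2}/√2) (log n)^{(αₙ-1)/2} / n^{αₙ}` as `n → ∞`,
where `γₙ(tQⁿ) = (√(2/π) ∫₀^t e^{-x²/2} dx)ⁿ`. -/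
theorem gaussian_cube_integral_asymptotics (α : ℕ → ℝ) (a : ℝ) (ha : 0 < a)
    (hα : Tendsto α atTop (nhds a)) :
    Tendsto (fun n : ℕ =>
        (∫ t in Set.Ioi (0 : ℝ),
            Real.exp (-(α n) * t ^ 2 / 2) *
              (Real.sqrt (2 / π) * ∫ x in (0 : ℝ)..t, Real.exp (-x ^ 2 / 2)) ^ n) /
          (Real.Gamma a * (π ^ (a / 2) / Real.sqrt 2) *
            (Real.log n) ^ ((α n - 1) / 2) / (n : ℝ) ^ (α n)))
      atTop (nhds 1) := by
  have hL : Tendsto (fun n : ℕ => Real.log n) atTop atTop :=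
    Real.tendsto_log_atTop.comp tendsto_natCast_atTop_atTop
  set c : ℕ → ℝ := fun n => √(2 * Real.log n - Real.log (Real.log n)) with hcdef
  have hr : Tendsto (fun n : ℕ => Real.log (Real.log n) / Real.log n) atTop (nhds 0) :=
    (Real.isLittleO_log_id_atTop.tendsto_div_nhds_zero).comp hL
  have eL : ∀ᶠ n : ℕ in atTop, 0 < Real.log n := hL.eventually_gt_atTop 0
  have en : ∀ᶠ n : ℕ in atTop, 0 < n := eventually_gt_atTop 0
  have hq : Tendsto (fun n : ℕ => 2 - Real.log (Real.log n) / Real.log n) atTop (nhds 2) := by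
    simpa using tendsto_const_nhds.sub hr
  have hX : Tendsto (fun n : ℕ => 2 * Real.log n - Real.log (Real.log n)) atTop atTop := by
    refine (hq.pos_mul_atTop two_pos hL).congr' ?_
    filter_upwards [eL] with n h
    field_simp
  have hc : Tendsto c atTop atTop := Real.tendsto_sqrt_atTop.comp hX
  have eX := hX.eventually_gt_atTop 0
  have hsq : ∀ᶠ n in atTop, c n ^ 2 = 2 * Real.log n - Real.log (Real.log n) := by
    filter_upwards [eX] with n h
    exact Real.sq_sqrt h.le
  have hh : Tendsto (fun n : ℕ => √(Real.log n) / c n) atTop (nhds (1 / √2)) := by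
    have : Tendsto (fun n : ℕ => 1 / √(2 - Real.log (Real.log n) / Real.log n)) atTop
        (nhds (1 / √2)) :=
      Tendsto.div tendsto_const_nhds ((Real.continuous_sqrt.tendsto _).comp hq) (by positivity)
    refine this.congr' ?_
    filter_upwards [eL] with n h
    have : 2 - Real.log (Real.log n) / Real.log n
        = (2 * Real.log n - Real.log (Real.log n)) / Real.log n := by field_simp
    rw [this, Real.sqrt_div' _ h.le, one_div_div]
  have hexp : ∀ᶠ n : ℕ in atTop, n * Real.exp (-c n ^ 2 / 2) = √(Real.log n) := by
    filter_upwards [hsq, eL, en] with n h1 h2 h3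
    have hn : (0:ℝ) < n := by exact_mod_cast h3
    have : -c n ^ 2 / 2 = -Real.log n + Real.log (Real.log n) / 2 := by rw [h1]; ring
    rw [this, Real.exp_add, Real.exp_neg, Real.exp_log hn, ← Real.log_sqrt h2.le,
      Real.exp_log (by positivity)]
    field_simp
  have hκ : √(2 / π) * (1 / √2) = 1 / √π := by
    rw [Real.sqrt_div (by norm_num)]
    field_simp
  have hcκ : Tendsto (fun n : ℕ => √(2 / π) * (n * Real.exp (-c n ^ 2 / 2) / c n)) atTop
      (nhds (1 / √π)) := by
    rw [← hκ]
    refine (hh.const_mul _).congr' ?_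
    filter_upwards [hexp] with n h
    rw [h]
  have hJ := main_tendsto ha hα (by positivity) hc hcκ
  have hG := Real.Gamma_pos_of_pos ha
  have hfin := (hJ.mul hh).div_const (Real.Gamma a * (π ^ (a / 2) / √2))
  have hone : (1 / (1 / √π)) ^ a * Real.Gamma a * (1 / √2) / (Real.Gamma a * (π ^ (a / 2) / √2))
      = 1 := by
    rw [one_div_one_div, Real.sqrt_eq_rpow π, ← Real.rpow_mul Real.pi_pos.le,
      show 1 / 2 * a = a / 2 by ring]
    field_simp
  rw [hone] at hfin
  refine hfin.congr' ?_
  filter_upwards [hexp, eL, en, hc.eventually_gt_atTop 0] with n h1 h2 h3 h4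
  have hn : (0:ℝ) < n := by exact_mod_cast h3
  have hres := rescale (α n) n h4
  simp only [FF] at hres ⊢
  rw [hres]
  have hE : Real.exp (-α n * c n ^ 2 / 2) = Real.log n ^ (α n / 2) / (n : ℝ) ^ α n := by
    have e : Real.exp (-c n ^ 2 / 2) = √(Real.log n) / n := by
      rw [← h1]; field_simp
    rw [show -α n * c n ^ 2 / 2 = (-c n ^ 2 / 2) * α n by ring, Real.exp_mul, e,
      Real.div_rpow (by positivity) hn.le, Real.sqrt_eq_rpow, ← Real.rpow_mul h2.le]
    congr 2
    ring
  have hP : Real.log n ^ (α n / 2) = Real.log n ^ ((α n - 1) / 2) * √(Real.log n) := by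
    rw [Real.sqrt_eq_rpow, ← Real.rpow_add h2]
    congr 1
    ring
  rw [hE, hP]
  have p1 : 0 < Real.log n ^ ((α n - 1) / 2) := Real.rpow_pos_of_pos h2 _
  have p2 : 0 < (n:ℝ) ^ α n := Real.rpow_pos_of_pos hn _
  field_simp
end
end
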